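/- Let r = q^l be a prime power with q prime and l ≥ 1. Then for all n ≥ 1, p_r(n) ≥ p_r(n+1): the probability that a random permutation of {1,...,n} has an r-th root is nonincreasing in n. -/

import Mathlib

open Finset

namespace Equiv.Perm

variable {α : Type*} [Fintype α] [DecidableEq α]

theorem minimalPeriod_eq_card_support_cycleOf {σ : Perm α} {x : α} (hx : σ x ≠ x) :
    Function.minimalPeriod σ x = #(σ.cycleOf x).support := by
  have hc := isCycle_cycleOf σ hx
  rw [← hc.orderOf]
  have key (n : ℕ) : σ.cycleOf x ^ n = 1 ↔ Function.IsPeriodicPt σ n x := by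
    rw [Function.IsPeriodicPt, Function.IsFixedPt, ← coe_pow, ← cycleOf_pow_apply_self]
    refine ⟨fun h => by simp [h], fun h => hc.pow_eq_one_iff.2 ⟨x, ?_, h⟩⟩
    rwa [cycleOf_apply_self]
  apply Nat.dvd_antisymm
  · exact ((key _).1 (pow_orderOf_eq_one _)).minimalPeriod_dvd
  · exact orderOf_dvd_of_pow_eq_one ((key _).2 (Function.isPeriodicPt_minimalPeriod _ _))

theorem minimalPeriod_eq_one_or_mem_cycleType (σ : Perm α) (x : α) :
    Function.minimalPeriod σ x = 1 ∨ Function.minimalPeriod σ x ∈ σ.cycleType := by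
  by_cases hx : σ x = x
  · exact Or.inl (Function.minimalPeriod_eq_one_iff_isFixedPt.2 hx)
  · right
    rw [minimalPeriod_eq_card_support_cycleOf hx, cycleType_def]
    exact Multiset.mem_map_of_mem (Finset.card ∘ support)
      (cycleOf_mem_cycleFactorsFinset_iff.2 (mem_support.2 hx))

theorem card_minimalPeriod_eq (σ : Perm α) {i : ℕ} (hi : 2 ≤ i) :
    #{x | Function.minimalPeriod σ x = i} = i * σ.cycleType.count i := by
  have h : ({x | Function.minimalPeriod σ x = i} : Finset α) =
      (σ.cycleFactorsFinset.filter (fun c => #c.support = i)).biUnion support := by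
    ext x
    simp only [mem_biUnion, mem_filter, mem_univ, true_and]
    constructor
    · intro hx
      have hx' : σ x ≠ x := fun h => by
        have := Function.minimalPeriod_eq_one_iff_isFixedPt.2 h
        omega
      refine ⟨σ.cycleOf x, ⟨cycleOf_mem_cycleFactorsFinset_iff.2 (mem_support.2 hx'), ?_⟩, ?_⟩
      · rw [← minimalPeriod_eq_card_support_cycleOf hx', hx]
      · rwa [mem_support, cycleOf_apply_self]
    · rintro ⟨c, ⟨hc, rfl⟩, hx⟩
      have hx' := mem_support.1 (mem_cycleFactorsFinset_support_le hc hx)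
      rw [minimalPeriod_eq_card_support_cycleOf hx', ← cycle_is_cycleOf hx hc]
  rw [h, card_biUnion, sum_const_nat (m := i), mul_comm, cycleType_def, Multiset.count_map]
  · simp only [Function.comp, eq_comm]
    rfl
  · simp
  · intro c hc d hd hcd
    exact (cycleFactorsFinset_pairwise_disjoint σ (mem_filter.1 hc).1
      (mem_filter.1 hd).1 hcd).disjoint_support

theorem minimalPeriod_pow {β : Type*} (σ : Perm β) {r : ℕ} (hr : r ≠ 0) (x : β) :
    Function.minimalPeriod (σ ^ r) x =
      Function.minimalPeriod σ x / (Function.minimalPeriod σ x).gcd r := by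
  rw [coe_pow, Function.minimalPeriod_iterate_eq_div_gcd hr]

end Equiv.Perm

theorem Nat.div_gcd_prime_pow_eq_iff {q l i m : ℕ} (hq : q.Prime) (hi : q ∣ i) (hm : m ≠ 0) :
    m / m.gcd (q ^ l) = i ↔ m = i * q ^ l := by
  constructor
  · intro h
    obtain ⟨a, ha, hg⟩ := (Nat.dvd_prime_pow hq).1 (Nat.gcd_dvd_right m (q ^ l))
    have hmi : m = i * q ^ a := by
      rw [← h, hg, Nat.div_mul_cancel (hg ▸ Nat.gcd_dvd_left m _)]
    rcases ha.eq_or_lt with rfl | hlt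
    · exact hmi
    · have h1 : q ^ (a + 1) ∣ m.gcd (q ^ l) := by
        refine Nat.dvd_gcd ?_ (pow_dvd_pow q hlt)
        rw [hmi, pow_succ']
        exact mul_dvd_mul_right hi _
      rw [hg] at h1
      have := (Nat.pow_dvd_pow_iff_le_right hq.one_lt).1 h1
      omega
  · rintro rfl
    rw [Nat.gcd_mul_left_left, Nat.mul_div_cancel _ (pow_pos hq.pos l)]

namespace Equiv.Perm

variable {α : Type*} [Fintype α] [DecidableEq α]

theorem minimalPeriod_ne_zero (σ : Perm α) (x : α) : Function.minimalPeriod σ x ≠ 0 := by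
  rcases minimalPeriod_eq_one_or_mem_cycleType σ x with h | h
  · omega
  · have := two_le_of_mem_cycleType h
    omega

theorem count_cycleType_pow_of_dvd (π : Perm α) {q l i : ℕ} (hq : q.Prime) (hi : q ∣ i) :
    (π ^ q ^ l).cycleType.count i = q ^ l * π.cycleType.count (i * q ^ l) := by
  rcases Nat.eq_zero_or_pos i with rfl | hi0
  · have h (τ : Perm α) : τ.cycleType.count 0 = 0 :=
      Multiset.count_eq_zero.2 fun h => by simpa using two_le_of_mem_cycleType h
    simp [h]
  have hi2 : 2 ≤ i := hq.two_le.trans (Nat.le_of_dvd hi0 hi)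
  have hql : 0 < q ^ l := pow_pos hq.pos l
  apply Nat.eq_of_mul_eq_mul_left hi0
  rw [← card_minimalPeriod_eq _ hi2, ← mul_assoc,
    ← card_minimalPeriod_eq _ (hi2.trans (Nat.le_mul_of_pos_right i hql))]
  congr 1
  ext x
  simp only [mem_filter_univ, minimalPeriod_pow π hql.ne',
    Nat.div_gcd_prime_pow_eq_iff hq hi (minimalPeriod_ne_zero π x)]

theorem count_cycleType_pow_of_not_dvd (π : Perm α) {q l i : ℕ} (hq : q.Prime) (hi : ¬ q ∣ i)
    (hπ : ∀ m ∈ π.cycleType, q ∣ m → q * q ^ l ∣ m) :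
    (π ^ q ^ l).cycleType.count i = π.cycleType.count i := by
  have hql : 0 < q ^ l := pow_pos hq.pos l
  by_cases hi2 : 2 ≤ i
  · apply Nat.eq_of_mul_eq_mul_left (show 0 < i by omega)
    rw [← card_minimalPeriod_eq _ hi2, ← card_minimalPeriod_eq _ hi2]
    congr 1
    ext x
    simp only [mem_filter_univ, minimalPeriod_pow π hql.ne']
    set m := Function.minimalPeriod π x with hm
    by_cases hqm : q ∣ m
    · have hmem : m ∈ π.cycleType := by
        refine (minimalPeriod_eq_one_or_mem_cycleType π x).resolve_left fun h => ?_
        rw [← hm] at h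
        rw [h] at hqm
        exact hq.one_lt.ne' (Nat.dvd_one.1 hqm)
      obtain ⟨k, hk⟩ := hπ m hmem hqm
      have h1 : m / m.gcd (q ^ l) = q * k := by
        rw [hk, mul_right_comm, Nat.gcd_mul_left_left, Nat.mul_div_cancel _ hql]
      rw [h1]
      exact ⟨fun h => absurd ⟨k, h.symm⟩ hi, fun h => absurd (h ▸ hqm) hi⟩
    · rw [Nat.Coprime.gcd_eq_one, Nat.div_one]
      exact Nat.Coprime.pow_right l ((Nat.Prime.coprime_iff_not_dvd hq).2 hqm).symm
  · have h (τ : Perm α) : τ.cycleType.count i = 0 :=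
      Multiset.count_eq_zero.2 fun h => hi2 (two_le_of_mem_cycleType h)
    simp [h]

/-- A permutation has a `q ^ l`-th root iff the number of its cycles of each length divisible by
`q` is divisible by `q ^ l`. -/
theorem exists_pow_prime_pow_eq_iff (σ : Perm α) {q l : ℕ} (hq : q.Prime) :
    (∃ π : Perm α, π ^ q ^ l = σ) ↔ ∀ i, q ∣ i → q ^ l ∣ σ.cycleType.count i := by
  constructor
  · rintro ⟨π, rfl⟩ i hi
    exact ⟨_, count_cycleType_pow_of_dvd π hq hi⟩
  · intro h
    have hql : 0 < q ^ l := pow_pos hq.pos l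
    obtain ⟨N, hN⟩ := (σ.cycleType.filter (q ∣ ·)).exists_smul_of_dvd_count (k := q ^ l)
      fun a ha => by
        rw [Multiset.count_filter_of_pos (Multiset.of_mem_filter ha)]
        exact h a (Multiset.of_mem_filter ha)
    have hNq : ∀ a ∈ N, q ∣ a ∧ a ∈ σ.cycleType := fun a ha => by
      have : a ∈ σ.cycleType.filter (q ∣ ·) := hN ▸ (Multiset.mem_nsmul.2 ⟨hql.ne', ha⟩)
      exact ⟨Multiset.of_mem_filter this, Multiset.mem_of_mem_filter this⟩
    set A := σ.cycleType.filter (¬ q ∣ ·) with hA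
    set M := A + N.map (· * q ^ l) with hM
    have hsum : M.sum ≤ Fintype.card α := by
      refine le_trans (le_of_eq ?_) σ.sum_cycleType_le
      rw [← Multiset.filter_add_not (q ∣ ·) σ.cycleType, hN, hM, Multiset.sum_add,
        Multiset.sum_add, Multiset.sum_nsmul, Multiset.sum_map_mul_right, Multiset.map_id', hA]
      simp only [smul_eq_mul]
      ring
    have hM2 : ∀ a ∈ M, 2 ≤ a := by
      intro a ha
      rcases Multiset.mem_add.1 ha with ha | ha
      · exact two_le_of_mem_cycleType (Multiset.mem_of_mem_filter ha)
      · obtain ⟨b, hb, rfl⟩ := Multiset.mem_map.1 ha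
        exact (two_le_of_mem_cycleType (hNq b hb).2).trans (Nat.le_mul_of_pos_right b hql)
    obtain ⟨π, hπ⟩ := (exists_with_cycleType_iff α).2 ⟨hsum, hM2⟩
    have hct : (π ^ q ^ l).cycleType = σ.cycleType := by
      ext i
      by_cases hi : q ∣ i
      · have h1 : A.count (i * q ^ l) = 0 :=
          Multiset.count_eq_zero.2 fun ha => Multiset.of_mem_filter ha (hi.mul_right _)
        rw [count_cycleType_pow_of_dvd π hq hi, hπ, hM, Multiset.count_add, h1, zero_add,
          Multiset.count_map_eq_count' _ _ (mul_left_injective₀ hql.ne'),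
          ← Multiset.count_nsmul, ← hN, Multiset.count_filter_of_pos hi]
      · have h1 : (N.map (· * q ^ l)).count i = 0 :=
          Multiset.count_eq_zero.2 fun ha => by
            obtain ⟨b, hb, rfl⟩ := Multiset.mem_map.1 ha
            exact hi ((hNq b hb).1.mul_right _)
        rw [count_cycleType_pow_of_not_dvd π hq hi, hπ, hM, Multiset.count_add, h1, add_zero,
          Multiset.count_filter_of_pos (p := fun a => ¬ q ∣ a) hi]
        intro m hm hqm
        rw [hπ, hM] at hm
        rcases Multiset.mem_add.1 hm with ha | ha
        · exact absurd hqm (Multiset.of_mem_filter (p := fun a => ¬ q ∣ a) ha)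
        · obtain ⟨b, hb, rfl⟩ := Multiset.mem_map.1 ha
          exact mul_dvd_mul_right (hNq b hb).1 _
    obtain ⟨c, hc⟩ := isConj_iff.1 (isConj_of_cycleType_eq hct)
    exact ⟨c * π * c⁻¹, by rw [conj_pow, hc]⟩

end Equiv.Perm

namespace Nat.Partition

theorem parts_eq_filter_add_replicate {n : ℕ} (p : n.Partition) :
    p.parts = p.parts.filter (2 ≤ ·) +
      Multiset.replicate (n - (p.parts.filter (2 ≤ ·)).sum) 1 := by
  have h1 : p.parts.filter (fun a => ¬ 2 ≤ a) =
      Multiset.replicate (Multiset.card (p.parts.filter (fun a => ¬ 2 ≤ a))) 1 := by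
    refine Multiset.eq_replicate.2 ⟨rfl, fun b hb => ?_⟩
    have := p.parts_pos (Multiset.mem_of_mem_filter hb)
    have := Multiset.of_mem_filter (p := fun a => ¬ 2 ≤ a) hb
    omega
  have h2 := Multiset.filter_add_not (2 ≤ ·) p.parts
  rw [h1] at h2
  have h3 := congrArg Multiset.sum h2
  rw [Multiset.sum_add, Multiset.sum_replicate, p.parts_sum, smul_eq_mul, mul_one] at h3
  have h4 : n - (p.parts.filter (2 ≤ ·)).sum =
      Multiset.card (p.parts.filter (fun a => ¬ 2 ≤ a)) := by omega
  rw [h4]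
  exact h2.symm

end Nat.Partition

namespace Equiv.Perm

variable {α : Type*} [Fintype α] [DecidableEq α]

theorem partition_eq_iff (σ : Perm α) (p : (Fintype.card α).Partition) :
    σ.partition = p ↔ σ.cycleType = p.parts.filter (2 ≤ ·) := by
  constructor
  · rintro rfl
    exact filter_parts_partition_eq_cycleType.symm
  · intro h
    rw [Nat.Partition.ext_iff, parts_partition, p.parts_eq_filter_add_replicate, ← h,
      sum_cycleType]

theorem card_partition_eq_mul (p : (Fintype.card α).Partition) :
    #{σ : Perm α | σ.partition = p} *
      ∏ i ∈ p.parts.toFinset, (i ^ p.parts.count i * (p.parts.count i).factorial) =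
      (Fintype.card α).factorial := by
  set m := p.parts.filter (2 ≤ ·) with hm
  set k := Fintype.card α - m.sum with hk
  have hp : p.parts = m + Multiset.replicate k 1 := p.parts_eq_filter_add_replicate
  have hsum : m.sum ≤ Fintype.card α := by
    have := congrArg Multiset.sum hp
    rw [p.parts_sum, Multiset.sum_add] at this
    omega
  have hm2 : ∀ a ∈ m, 2 ≤ a := fun a ha => Multiset.of_mem_filter (p := fun a => 2 ≤ a) ha
  have hm1 : 1 ∉ m.toFinset := fun h => by
    have := hm2 1 (Multiset.mem_toFinset.1 h)
    omega
  have hcount1 : m.count 1 = 0 := Multiset.count_eq_zero.2 fun h => hm1 (Multiset.mem_toFinset.2 h)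
  have h1 : ∏ i ∈ p.parts.toFinset, i ^ p.parts.count i = m.prod := by
    rw [← Finset.prod_multiset_count, hp, Multiset.prod_add, Multiset.prod_replicate, one_pow,
      mul_one]
  have h2 : ∏ i ∈ p.parts.toFinset, (p.parts.count i).factorial =
      k.factorial * ∏ i ∈ m.toFinset, (m.count i).factorial := by
    have hsub : p.parts.toFinset ⊆ insert 1 m.toFinset := by
      intro i hi
      rw [Multiset.mem_toFinset, hp, Multiset.mem_add] at hi
      rcases hi with hi | hi
      · exact mem_insert_of_mem (Multiset.mem_toFinset.2 hi)
      · rw [Multiset.eq_of_mem_replicate hi]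
        exact mem_insert_self _ _
    rw [prod_subset hsub, prod_insert hm1]
    · congr 1
      · rw [hp, Multiset.count_add, hcount1, Multiset.count_replicate_self, zero_add]
      · refine prod_congr rfl fun i hi => ?_
        have : i ≠ 1 := fun h => hm1 (h ▸ hi)
        rw [hp, Multiset.count_add, Multiset.count_replicate, if_neg (Ne.symm this), add_zero]
    · intro i _ hi
      rw [Multiset.mem_toFinset] at hi
      rw [Multiset.count_eq_zero.2 hi, Nat.factorial_zero]
  rw [prod_mul_distrib, h1, h2, ← mul_assoc m.prod, mul_comm m.prod]
  have := card_of_cycleType_mul_eq α m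
  rw [if_pos ⟨hsum, hm2⟩] at this
  rw [← this]
  simp only [partition_eq_iff, ← hm, hk]

theorem dvd_count_partition_iff (σ : Perm α) {q r : ℕ} (hq : q.Prime) :
    (∀ i, q ∣ i → r ∣ σ.partition.parts.count i) ↔ ∀ i, q ∣ i → r ∣ σ.cycleType.count i := by
  refine forall₂_congr fun i hi => ?_
  have : 1 ≠ i := by
    rintro rfl
    exact hq.one_lt.ne' (Nat.dvd_one.1 hi)
  rw [parts_partition, Multiset.count_add, Multiset.count_replicate, if_neg this, add_zero]

end Equiv.Perm

/-- The exponential weight of `c` cycles of length `i`, zero unless `c` such cycles can occur in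
a permutation having a `q ^ l`-th root. -/
noncomputable def rootWeight (q l i c : ℕ) : ℚ :=
  if q ∣ i → q ^ l ∣ c then ((i : ℚ) ^ c * c.factorial)⁻¹ else 0

theorem card_root_div_factorial {α : Type*} [Fintype α] {q l : ℕ} (hq : q.Prime) :
    (Nat.card {σ : Equiv.Perm α // ∃ π, π ^ q ^ l = σ} : ℚ) / (Fintype.card α).factorial =
      (Nat.Partition.genFun (rootWeight q l)).coeff (Fintype.card α) := by
  classical
  have h0 : (Fintype.card α).factorial ≠ (0 : ℚ) := by positivity
  have hcard : Nat.card {σ : Equiv.Perm α // ∃ π, π ^ q ^ l = σ} =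
      ∑ p : (Fintype.card α).Partition,
        if ∀ i, q ∣ i → q ^ l ∣ p.parts.count i then #{σ : Equiv.Perm α | σ.partition = p}
          else 0 := by
    rw [Nat.card_eq_fintype_card, Fintype.card_subtype,
      card_eq_sum_card_fiberwise (f := Equiv.Perm.partition) (t := univ) (by simp)]
    refine sum_congr rfl fun p _ => ?_
    rw [filter_filter]
    split_ifs with hp
    · congr 1
      refine filter_congr fun σ _ => and_iff_right_of_imp ?_
      rintro rfl
      rwa [Equiv.Perm.exists_pow_prime_pow_eq_iff σ hq, ← σ.dvd_count_partition_iff hq]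
    · rw [card_eq_zero, filter_eq_empty_iff]
      rintro σ _ ⟨h, rfl⟩
      rw [Equiv.Perm.exists_pow_prime_pow_eq_iff σ hq, ← σ.dvd_count_partition_iff hq] at h
      exact hp h
  rw [hcard, Nat.Partition.coeff_genFun, Nat.cast_sum, sum_div]
  refine sum_congr rfl fun p _ => ?_
  rw [Finsupp.prod, Multiset.toFinsupp_support]
  simp only [Multiset.toFinsupp_apply]
  split_ifs with hp
  · rw [prod_congr rfl fun i _ => show rootWeight q l i (p.parts.count i) =
      ((i : ℚ) ^ p.parts.count i * (p.parts.count i).factorial)⁻¹ from if_pos (hp i),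
      prod_inv_distrib, div_eq_iff h0, ← Equiv.Perm.card_partition_eq_mul p]
    push_cast
    rw [mul_left_comm, inv_mul_cancel₀, mul_one]
    refine prod_ne_zero_iff.2 fun i hi => ?_
    have := p.parts_pos (Multiset.mem_toFinset.1 hi)
    positivity
  · push Not at hp
    obtain ⟨i, hi, hc⟩ := hp
    rw [Nat.cast_zero, zero_div, prod_eq_zero (i := i)]
    · rw [Multiset.mem_toFinset, ← Multiset.count_ne_zero]
      exact fun h => hc (h ▸ dvd_zero _)
    · exact if_neg fun h => hc (h hi)

open PowerSeries
open scoped PowerSeries.WithPiTopology in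
theorem Nat.Partition.exists_finset_coeff_genFun_eq {R : Type*} [CommSemiring R]
    (f : ℕ → ℕ → R) (N : ℕ) :
    ∃ s : Finset ℕ, Icc 1 N ⊆ s ∧ 0 ∉ s ∧ ∀ k ≤ N, (genFun f).coeff k =
      (∏ i ∈ s, PowerSeries.mk fun k => if k = 0 then 1 else
        if i ∣ k then f i (k / i) else 0).coeff k := by
  let _ : TopologicalSpace R := ⊥
  have : DiscreteTopology R := ⟨rfl⟩
  have hE (i : ℕ) (hi : i ≠ 0) : (1 : R⟦X⟧) + ∑' j, f i (j + 1) • X ^ (i * (j + 1)) =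
      PowerSeries.mk fun k => if k = 0 then 1 else if i ∣ k then f i (k / i) else 0 := by
    ext k
    rw [map_add, (summable_genFun_term' f hi).map_tsum _ (WithPiTopology.continuous_coeff _ _),
      coeff_mk, coeff_one]
    simp only [map_smul, coeff_X_pow, smul_eq_mul, mul_ite, mul_one, mul_zero]
    by_cases hk : k = 0
    · subst hk
      simp [hi]
    by_cases hik : i ∣ k
    · obtain ⟨c, rfl⟩ := hik
      obtain ⟨c, rfl⟩ := Nat.exists_eq_add_one_of_ne_zero (right_ne_zero_of_mul hk)
      rw [tsum_eq_single c]
      · simp [hi]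
      · intro b hb
        rw [if_neg]
        simpa [hi] using hb.symm
    · have (j : ℕ) : k ≠ i * (j + 1) := fun h => hik ⟨_, h⟩
      simp [hk, hik, this]
  have h := hasProd_genFun f
  rw [HasProd, WithPiTopology.tendsto_iff_coeff_tendsto] at h
  have h1 : ∀ᶠ s : Finset ℕ in Filter.atTop, ∀ k ∈ Set.Iic N,
      (∏ i ∈ s, ((1 : R⟦X⟧) + ∑' j, f (i + 1) (j + 1) • X ^ ((i + 1) * (j + 1)))).coeff k =
        (genFun f).coeff k := by
    rw [Filter.eventually_all_finite (Set.finite_Iic N)]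
    intro k _
    have := h k
    rw [nhds_discrete, Filter.tendsto_pure] at this
    exact this
  obtain ⟨s, hs, hN⟩ := (h1.and (Filter.eventually_ge_atTop (range N))).exists
  refine ⟨s.map (addRightEmbedding 1), fun i hi => ?_, by simp, fun k hk => ?_⟩
  · rw [mem_Icc] at hi
    rw [mem_map]
    exact ⟨i - 1, hN (mem_range.2 (by omega)), by simp only [addRightEmbedding_apply]; omega⟩
  · rw [← hs k hk, prod_map]
    congr 1
    exact prod_congr rfl fun i _ => hE _ (by simp)

/-- The exponential generating series of permutations all of whose cycles have length `i`, the
number of cycles being divisible by `d`. -/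
noncomputable def cycleSeries (i d : ℕ) : ℚ⟦X⟧ :=
  PowerSeries.mk fun k => if i * d ∣ k then ((i : ℚ) ^ (k / i) * (k / i).factorial)⁻¹ else 0

theorem coeff_cycleSeries_mul (i d : ℕ) (hi : i ≠ 0) (c : ℕ) :
    (cycleSeries i d).coeff (i * d * c) = ((i : ℚ) ^ (d * c) * (d * c).factorial)⁻¹ := by
  rw [cycleSeries, coeff_mk, if_pos (dvd_mul_right _ _), mul_assoc,
    Nat.mul_div_cancel_left _ (Nat.pos_of_ne_zero hi)]

theorem coeff_cycleSeries_of_not_dvd {i d k : ℕ} (h : ¬ i * d ∣ k) :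
    (cycleSeries i d).coeff k = 0 := by
  rw [cycleSeries, coeff_mk, if_neg h]

theorem coeff_cycleSeries_nonneg (i d k : ℕ) : 0 ≤ (cycleSeries i d).coeff k := by
  rw [cycleSeries, coeff_mk]
  split_ifs <;> positivity

theorem exists_finset_card_root_eq {q l : ℕ} (hq : q.Prime) (N : ℕ) :
    ∃ s : Finset ℕ, Icc 1 N ⊆ s ∧ 0 ∉ s ∧ ∀ n ≤ N,
      (Nat.card {σ : Equiv.Perm (Fin n) // ∃ π, π ^ q ^ l = σ} : ℚ) / n.factorial =
        (∏ i ∈ s, cycleSeries i (if q ∣ i then q ^ l else 1)).coeff n := by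
  obtain ⟨s, hs, h0, h⟩ := Nat.Partition.exists_finset_coeff_genFun_eq (rootWeight q l) N
  refine ⟨s, hs, h0, fun n hn => ?_⟩
  have h1 := card_root_div_factorial (α := Fin n) (l := l) hq
  rw [Fintype.card_fin] at h1
  rw [h1, h n hn]
  congr 1
  refine prod_congr rfl fun i hi => ?_
  have hi0 : 0 < i := Nat.pos_of_ne_zero fun h => h0 (h ▸ hi)
  ext k
  rw [coeff_mk, cycleSeries, coeff_mk]
  by_cases hk : k = 0
  · simp [hk]
  rw [if_neg hk]
  by_cases hik : i ∣ k
  · obtain ⟨c, rfl⟩ := hik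
    rw [if_pos (dvd_mul_right _ _), Nat.mul_div_cancel_left _ hi0, rootWeight]
    refine if_congr ?_ rfl rfl
    rw [Nat.mul_dvd_mul_iff_left hi0]
    split_ifs with hqi <;> simp [hqi]
  · rw [if_neg hik, if_neg fun h => hik (dvd_of_mul_right_dvd h)]

theorem PowerSeries.coeff_X_mul_derivative (F : ℚ⟦X⟧) (k : ℕ) :
    (X * d⁄dX ℚ F).coeff k = k * F.coeff k := by
  cases k with
  | zero => simp
  | succ k =>
    rw [coeff_succ_X_mul, coeff_derivative, mul_comm]
    push_cast
    ring

theorem X_mul_derivative_cycleSeries_one {i : ℕ} (hi : i ≠ 0) :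
    X * d⁄dX ℚ (cycleSeries i 1) = cycleSeries i 1 * X ^ i := by
  ext k
  rw [coeff_X_mul_derivative, coeff_mul_X_pow']
  by_cases hk : i * 1 ∣ k
  · obtain ⟨c, rfl⟩ := hk
    rw [coeff_cycleSeries_mul i 1 hi]
    cases c with
    | zero => simp [hi]
    | succ c =>
      rw [mul_one, if_pos (Nat.le_mul_of_pos_right i c.succ_pos),
        show i * (c + 1) - i = i * 1 * c by rw [mul_add, mul_one, Nat.add_sub_cancel],
        coeff_cycleSeries_mul i 1 hi, one_mul, one_mul, Nat.factorial_succ]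
      have : (i : ℚ) ≠ 0 := by exact_mod_cast hi
      push_cast
      field_simp
      ring
  · rw [coeff_cycleSeries_of_not_dvd hk]
    split_ifs with hik
    · rw [coeff_cycleSeries_of_not_dvd, mul_zero]
      rw [mul_one] at hk ⊢
      exact fun h => hk ((Nat.dvd_sub_iff_left hik dvd_rfl).1 h)
    · simp

theorem coeff_X_mul_derivative_cycleSeries_le {i d : ℕ} (hi : i ≠ 0) (hd : d ≠ 0) (k : ℕ) :
    (X * d⁄dX ℚ (cycleSeries i d)).coeff k ≤
      (cycleSeries i d *
        (C ((i : ℚ) / (i ^ d * (d - 1).factorial)) * X ^ (i * d))).coeff k := by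
  rw [coeff_X_mul_derivative, mul_left_comm, coeff_C_mul, coeff_mul_X_pow']
  by_cases hk : i * d ∣ k
  · obtain ⟨c, rfl⟩ := hk
    rw [coeff_cycleSeries_mul i d hi]
    cases c with
    | zero => simp [hi, hd]
    | succ c =>
      rw [if_pos (Nat.le_mul_of_pos_right _ c.succ_pos),
        show i * d * (c + 1) - i * d = i * d * c by rw [mul_add, mul_one, Nat.add_sub_cancel],
        coeff_cycleSeries_mul i d hi]
      obtain ⟨e, rfl⟩ := Nat.exists_eq_add_one_of_ne_zero hd
      have hfac : e.factorial * ((e + 1) * c).factorial ≤ (e + (e + 1) * c).factorial :=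
        Nat.le_of_dvd (Nat.factorial_pos _) (Nat.factorial_mul_factorial_dvd_factorial_add _ _)
      have hfac' : (e.factorial : ℚ) * ((e + 1) * c).factorial ≤ (e + (e + 1) * c).factorial := by
        exact_mod_cast hfac
      rw [show (e + 1) * (c + 1) = e + (e + 1) * c + 1 by ring, Nat.factorial_succ,
        Nat.add_sub_cancel]
      have hi' : (0 : ℚ) < i := by exact_mod_cast Nat.pos_of_ne_zero hi
      have e1 : ((i * (e + 1) * (c + 1) : ℕ) : ℚ) * ((i : ℚ) ^ (e + (e + 1) * c + 1) *
          ((e + (e + 1) * c + 1) * (e + (e + 1) * c).factorial : ℕ))⁻¹ =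
          i / (i ^ (e + (e + 1) * c + 1) * (e + (e + 1) * c).factorial) := by
        have : (e : ℚ) + (e + 1) * c + 1 ≠ 0 := by positivity
        push_cast
        field_simp
        ring
      have e2 : (i : ℚ) / (i ^ (e + 1) * e.factorial) *
          ((i : ℚ) ^ ((e + 1) * c) * ((e + 1) * c).factorial)⁻¹ =
          i / (i ^ (e + (e + 1) * c + 1) * (e.factorial * ((e + 1) * c).factorial)) := by
        field_simp
        ring
      rw [e1, e2]
      gcongr
  · rw [coeff_cycleSeries_of_not_dvd hk, mul_zero]
    split_ifs
    · have := coeff_cycleSeries_nonneg i d (k - i * d)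
      positivity
    · simp

namespace PowerSeries

variable {s : Finset ℕ} {E G : ℕ → ℚ⟦X⟧}

theorem coeff_mul_nonneg {F G : ℚ⟦X⟧} (hF : ∀ k, 0 ≤ F.coeff k) (hG : ∀ k, 0 ≤ G.coeff k)
    (k : ℕ) : 0 ≤ (F * G).coeff k := by
  rw [coeff_mul]
  exact sum_nonneg fun p _ => mul_nonneg (hF _) (hG _)

theorem coeff_prod_nonneg (hE : ∀ i ∈ s, ∀ k, 0 ≤ (E i).coeff k) (k : ℕ) :
    0 ≤ (∏ i ∈ s, E i).coeff k := by
  refine prod_induction E (fun F => ∀ k, 0 ≤ F.coeff k)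
    (fun _ _ => coeff_mul_nonneg) (fun k => ?_) hE k
  rw [coeff_one]
  split_ifs <;> norm_num

theorem coeff_prod_eq_zero_of_not_dvd {q : ℕ}
    (hE : ∀ i ∈ s, ∀ k, ¬ q ∣ k → (E i).coeff k = 0) {k : ℕ} (hk : ¬ q ∣ k) :
    (∏ i ∈ s, E i).coeff k = 0 := by
  refine prod_induction E (fun F => ∀ k, ¬ q ∣ k → F.coeff k = 0)
    (fun F G hF hG k hk => ?_) (fun k hk => ?_) hE k hk
  · rw [coeff_mul]
    refine sum_eq_zero fun p hp => ?_
    rw [HasAntidiagonal.mem_antidiagonal] at hp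
    by_cases h1 : q ∣ p.1
    · rw [hG _ fun h2 => hk (hp ▸ dvd_add h1 h2), mul_zero]
    · rw [hF _ h1, zero_mul]
  · rw [coeff_one, if_neg]
    rintro rfl
    exact hk (dvd_zero q)

theorem X_mul_derivative_prod (h : ∀ i ∈ s, X * d⁄dX ℚ (E i) = E i * G i) :
    X * d⁄dX ℚ (∏ i ∈ s, E i) = (∏ i ∈ s, E i) * ∑ i ∈ s, G i := by
  induction s using Finset.induction_on with
  | empty => simp
  | insert a s ha ih =>
    rw [prod_insert ha, sum_insert ha, Derivation.leibniz, smul_eq_mul, smul_eq_mul]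
    have h1 := ih fun i hi => h i (mem_insert_of_mem hi)
    have h2 := h a (mem_insert_self _ _)
    linear_combination E a * h1 + (∏ i ∈ s, E i) * h2

theorem coeff_X_mul_derivative_prod_le (hE : ∀ i ∈ s, ∀ k, 0 ≤ (E i).coeff k)
    (h : ∀ i ∈ s, ∀ k, (X * d⁄dX ℚ (E i)).coeff k ≤ (E i * G i).coeff k) (k : ℕ) :
    (X * d⁄dX ℚ (∏ i ∈ s, E i)).coeff k ≤ ((∏ i ∈ s, E i) * ∑ i ∈ s, G i).coeff k := by
  induction s using Finset.induction_on generalizing k with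
  | empty => simp
  | insert a s ha ih =>
    have hs := fun i hi => hE i (mem_insert_of_mem hi)
    have h1 := ih hs fun i hi => h i (mem_insert_of_mem hi)
    have h2 := h a (mem_insert_self _ _)
    have h3 := coeff_mul_nonneg (hE a (mem_insert_self _ _))
      (G := (∏ i ∈ s, E i) * ∑ i ∈ s, G i - X * d⁄dX ℚ (∏ i ∈ s, E i))
      (fun k => by rw [map_sub]; exact sub_nonneg.2 (h1 k)) k
    have h4 := coeff_mul_nonneg (coeff_prod_nonneg hs)
      (G := E a * G a - X * d⁄dX ℚ (E a))
      (fun k => by rw [map_sub]; exact sub_nonneg.2 (h2 k)) k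
    rw [prod_insert ha, sum_insert ha, Derivation.leibniz, smul_eq_mul, smul_eq_mul,
      ← sub_nonneg, ← map_sub]
    have h5 := add_nonneg h3 h4
    rw [← map_add] at h5
    refine h5.trans_eq (congrArg _ ?_)
    ring

end PowerSeries

/-- The recursion satisfied by the proportion `R k` of permutations of `k` points having no cycle
of length divisible by `q`. -/
theorem regular_step {q N : ℕ} (hq : 2 ≤ q) {R : ℕ → ℚ}
    (hR : ∀ k ≤ N, k * R k = ∑ i ∈ range k, if q ∣ i + 1 then 0 else R (k - 1 - i)) :
    ∀ k, k + 1 ≤ N → (¬ q ∣ k + 1 → R (k + 1) = R k) ∧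
      (q ∣ k + 1 → (k + 1) * R (k + 1) = k * R k) := by
  obtain ⟨Q, rfl⟩ := Nat.exists_eq_add_of_le' (show 1 ≤ q by omega)
  have step (m : ℕ) (hm : m + (Q + 1) ≤ N) : ((m + (Q + 1) : ℕ) : ℚ) * R (m + (Q + 1)) =
      m * R m + ∑ i ∈ range Q, R (m + Q - i) := by
    rw [hR _ hm, hR m (by omega), add_comm m (Q + 1), sum_range_add, sum_range_succ,
      if_pos dvd_rfl, add_zero, add_comm]
    congr 1
    · refine sum_congr rfl fun i _ => ?_
      refine if_congr ?_ rfl (congrArg R (by omega))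
      rw [add_assoc (Q + 1) i 1, Nat.dvd_add_right dvd_rfl]
    · refine sum_congr rfl fun i hi => ?_
      rw [mem_range] at hi
      rw [if_neg fun h => absurd (Nat.le_of_dvd (by omega) h) (by omega)]
      congr 1
      omega
  intro k
  induction k using Nat.strong_induction_on with
  | _ k ih =>
  intro hk
  rcases lt_or_ge (k + 1) (Q + 1) with hlt | hge
  · refine ⟨fun _ => ?_, fun h => absurd (Nat.le_of_dvd (by omega) h) (by omega)⟩
    have h0 (j : ℕ) (hj : j ≤ k + 1) : (j : ℚ) * R j = ∑ i ∈ range j, R (j - 1 - i) := by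
      rw [hR j (by omega)]
      refine sum_congr rfl fun i hi => ?_
      rw [mem_range] at hi
      rw [if_neg fun h => absurd (Nat.le_of_dvd (by omega) h) (by omega)]
    have h1 := h0 (k + 1) le_rfl
    rw [sum_range_succ', sum_congr rfl fun i _ => show R (k + 1 - 1 - (i + 1)) = R (k - 1 - i) by
      congr 1; omega, ← h0 k (by omega)] at h1
    simp only [Nat.add_sub_cancel, Nat.sub_zero] at h1
    have h2 : ((k + 1 : ℕ) : ℚ) ≠ 0 := by positivity
    refine mul_left_cancel₀ h2 ?_
    rw [h1]
    push_cast
    ring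
  · obtain ⟨m, hm⟩ := Nat.exists_eq_add_of_le' hge
    obtain rfl : k = m + Q := by omega
    have h1 := step m (by omega)
    by_cases hqm : Q + 1 ∣ m
    · have hblock (j : ℕ) (hj : j ≤ Q) : R (m + j) = R m := by
        induction j with
        | zero => rfl
        | succ j ihj =>
          rw [← ihj (by omega)]
          refine (ih (m + j) (by omega) (by omega)).1 fun h => ?_
          rw [add_assoc, Nat.dvd_add_right hqm] at h
          exact absurd (Nat.le_of_dvd (by omega) h) (by omega)
      refine ⟨fun h => absurd (hm ▸ hqm.add dvd_rfl) h, fun _ => ?_⟩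
      rw [sum_congr rfl fun i hi => show R (m + Q - i) = R m by
        rw [mem_range] at hi
        rw [show m + Q - i = m + (Q - i) by omega, hblock _ (by omega)],
        sum_const, card_range, nsmul_eq_mul] at h1
      rw [add_assoc m Q 1, hblock Q le_rfl]
      push_cast at h1 ⊢
      linear_combination h1
    · refine ⟨fun _ => ?_, fun h => ?_⟩
      · obtain ⟨m, rfl⟩ := Nat.exists_eq_add_one_of_ne_zero (n := m)
          (by rintro rfl; exact hqm (dvd_zero _))
        have h2 := step m (by omega)
        have h3 := (ih m (by omega) (by omega)).1 hqm
        have h4 := sum_range_succ (fun i => R (m + 1 + Q - i)) Q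
        rw [sum_range_succ', sum_congr rfl fun i _ =>
          show R (m + 1 + Q - (i + 1)) = R (m + Q - i) by congr 1; omega] at h4
        simp only [Nat.sub_zero, Nat.add_sub_cancel] at h4
        have h5 : ((m + 1 + Q + 1 : ℕ) : ℚ) ≠ 0 := by positivity
        refine mul_left_cancel₀ h5 ?_
        rw [← add_assoc] at h1
        rw [show m + (Q + 1) = m + 1 + Q by ring] at h2
        rw [h1]
        push_cast at h2 ⊢
        linear_combination -h4 - h2 + m * h3
      · rw [add_assoc] at h
        exact absurd ((Nat.dvd_add_left dvd_rfl).1 h) hqm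

theorem regular_lower_bound {q N : ℕ} (hq : 2 ≤ q) {R : ℕ → ℚ} (h0 : R 0 = 1)
    (hR : ∀ k, k + 1 ≤ N → (¬ q ∣ k + 1 → R (k + 1) = R k) ∧
      (q ∣ k + 1 → (k + 1) * R (k + 1) = k * R k)) :
    ∀ k, k + 1 ≤ N → q ∣ k + 1 → (q : ℚ) / (k + 1) ^ 2 ≤ R k - R (k + 1) := by
  have hblock (m j : ℕ) (hm : q ∣ m) (hj : j < q) (hN : m + j ≤ N) : R (m + j) = R m := by
    induction j with
    | zero => rfl
    | succ j ihj =>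
      rw [← ihj (by omega) (by omega)]
      refine (hR (m + j) (by omega)).1 fun h => ?_
      rw [add_assoc, Nat.dvd_add_right hm] at h
      exact absurd (Nat.le_of_dvd (by omega) h) (by omega)
  have hq' : (2 : ℚ) ≤ q := by exact_mod_cast hq
  have hstep (t : ℕ) (ht : q * (t + 1) ≤ N) :
      (q * (t + 1) : ℚ) * R (q * (t + 1)) = (q * (t + 1) - 1) * R (q * t) := by
    have h1 : q * (t + 1) = q * t + (q - 1) + 1 := by rw [mul_add]; omega
    have h2 := (hR (q * t + (q - 1)) (by omega)).2 (h1 ▸ dvd_mul_right q (t + 1))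
    rw [← h1, hblock (q * t) (q - 1) (dvd_mul_right _ _) (by omega) (by omega)] at h2
    push_cast [show 1 ≤ q by omega] at h2
    linear_combination h2
  have hlow (t : ℕ) (ht : q * t ≤ N) : (1 : ℚ) / (t + 1) ≤ R (q * t) := by
    induction t with
    | zero => simp [h0]
    | succ t ih =>
      have h1 := ih ((Nat.mul_le_mul_left q t.le_succ).trans ht)
      have h2 := hstep t ht
      have h3 : (0 : ℚ) < q * (t + 1) := by positivity
      have h4 : R (q * (t + 1)) = (q * (t + 1) - 1) / (q * (t + 1)) * R (q * t) := by
        rw [div_mul_eq_mul_div, ← h2, mul_div_cancel_left₀ _ h3.ne']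
      have ht0 : (0 : ℚ) ≤ t := t.cast_nonneg
      have h5 : (0 : ℚ) ≤ q * (t + 1) - 1 := by nlinarith
      rw [h4]
      refine le_trans ?_ (mul_le_mul_of_nonneg_left h1 (by positivity))
      rw [div_mul_div_comm, mul_one, div_le_div_iff₀ (by positivity) (by positivity)]
      push_cast
      nlinarith [mul_nonneg (sub_nonneg.2 hq') (by positivity : (0 : ℚ) ≤ t + 1)]
  intro k hk hqk
  obtain ⟨t, ht⟩ := hqk
  obtain ⟨t, rfl⟩ := Nat.exists_eq_add_one_of_ne_zero (n := t) (by rintro rfl; omega)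
  have h1 : k = q * t + (q - 1) := by rw [mul_add] at ht; omega
  have h2 : R k = R (q * t) := by
    rw [h1]
    exact hblock _ _ (dvd_mul_right _ _) (by omega) (by omega)
  have h3 := hstep t (by omega)
  have h4 := hlow t (by rw [mul_add] at ht; omega)
  have h5 : (k : ℚ) + 1 = q * (t + 1) := by exact_mod_cast ht
  have h6 : (0 : ℚ) < q * (t + 1) := by positivity
  have h7 : R k - R (k + 1) = R (q * t) / (q * (t + 1)) := by
    rw [h2, ht, eq_div_iff h6.ne']
    linear_combination -h3
  rw [h7, h5]
  refine le_trans (le_of_eq ?_) (div_le_div_of_nonneg_right h4 h6.le)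
  field_simp

theorem div_pow_mul_factorial_le {q r i N : ℕ} (hq : 2 ≤ q) (hqi : q ∣ i) (hi : i ≠ 0)
    (hr : 2 ≤ r) (hN : i * r ≤ N) :
    (i : ℚ) / (i ^ r * (r - 1).factorial) ≤ N * (q / (i * r) ^ 2) := by
  obtain ⟨e, rfl⟩ := Nat.exists_eq_add_of_le' hr
  have hi2 : 2 ≤ i := hq.trans (Nat.le_of_dvd (Nat.pos_of_ne_zero hi) hqi)
  have h1 : e + 2 ≤ q * i ^ e :=
    calc e + 2 ≤ 2 * 2 ^ e := by
          have := Nat.lt_two_pow_self (n := e + 1)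
          rw [pow_succ] at this
          omega
      _ ≤ q * i ^ e := Nat.mul_le_mul hq (Nat.pow_le_pow_left hi2 e)
  have h2 : ((e : ℚ) + 2) ≤ q * i ^ e := by exact_mod_cast h1
  have h3 : (i : ℚ) * (e + 2) ≤ N := by exact_mod_cast hN
  have h4 : (1 : ℚ) ≤ (e + 1).factorial := by exact_mod_cast Nat.factorial_pos _
  have hi' : (0 : ℚ) < i := by exact_mod_cast Nat.pos_of_ne_zero hi
  rw [show e + 2 - 1 = e + 1 from rfl]
  push_cast
  calc (i : ℚ) / (i ^ (e + 2) * (e + 1).factorial) ≤ i / (i ^ (e + 2) * 1) := by gcongr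
    _ ≤ q / (i * (e + 2)) := by
        rw [div_le_div_iff₀ (by positivity) (by positivity)]
        calc (i : ℚ) * (i * (e + 2)) ≤ i * (i * (q * i ^ e)) := by gcongr
          _ = q * (i ^ (e + 2) * 1) := by ring
    _ = i * (e + 2) * (q / (i * (e + 2)) ^ 2) := by
        have : (e : ℚ) + 2 ≠ 0 := by positivity
        field_simp
    _ ≤ N * (q / (i * (e + 2)) ^ 2) := by gcongr

theorem coeff_prod_cycleSeries_one_step {q N : ℕ} (hq : 2 ≤ q) {s : Finset ℕ}
    (hs : Icc 1 N ⊆ s) (h0 : 0 ∉ s) :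
    ∀ k, k + 1 ≤ N →
      (¬ q ∣ k + 1 → (∏ i ∈ s with ¬ q ∣ i, cycleSeries i 1).coeff (k + 1) =
        (∏ i ∈ s with ¬ q ∣ i, cycleSeries i 1).coeff k) ∧
      (q ∣ k + 1 → (k + 1) * (∏ i ∈ s with ¬ q ∣ i, cycleSeries i 1).coeff (k + 1) =
        k * (∏ i ∈ s with ¬ q ∣ i, cycleSeries i 1).coeff k) := by
  refine regular_step hq (R := fun k => (∏ i ∈ s with ¬ q ∣ i, cycleSeries i 1).coeff k)
    fun k hk => ?_
  have h := X_mul_derivative_prod (s := s.filter (¬ q ∣ ·)) (E := fun i => cycleSeries i 1)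
    (G := fun i => X ^ i) fun i hi => X_mul_derivative_cycleSeries_one
      fun h => h0 (h ▸ (mem_filter.1 hi).1)
  have h1 := congrArg (coeff k) h
  rw [coeff_X_mul_derivative, mul_sum, map_sum] at h1
  simp only [coeff_mul_X_pow'] at h1
  have h2 := sum_Ico_add' (fun i => if q ∣ i then 0 else
    (∏ i ∈ s with ¬ q ∣ i, cycleSeries i 1).coeff (k - i)) 0 k 1
  simp only [Nat.sub_sub, add_comm 1]
  rw [h1, range_eq_Ico, h2, sum_filter]
  symm
  refine sum_subset_zero_on_sdiff (fun i hi => hs ?_) (fun i hi => ?_) fun i hi => ?_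
  · rw [mem_Ico] at hi
    rw [mem_Icc]
    omega
  · rw [mem_sdiff, mem_Ico] at hi
    have : i ≠ 0 := fun h => h0 (h ▸ hi.1)
    rw [if_neg (by omega : ¬ i ≤ k), ite_self]
  · rw [mem_Ico] at hi
    rw [if_pos (by omega : i ≤ k), ite_not]

theorem coeff_prod_cycleSeries_le {q r N : ℕ} (hq : 2 ≤ q) (hr : 2 ≤ r) (hN : 0 < N)
    (hqN : q ∣ N) {s : Finset ℕ} (h0 : 0 ∉ s) {D : ℕ → ℚ}
    (hD : ∀ a < N, q ∣ a → (q : ℚ) / (N - a : ℕ) ^ 2 ≤ D a) :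
    (∏ i ∈ s with q ∣ i, cycleSeries i r).coeff N ≤
      ∑ a ∈ range N, (∏ i ∈ s with q ∣ i, cycleSeries i r).coeff a * D a := by
  have hs0 {i : ℕ} (hi : i ∈ s.filter (q ∣ ·)) : i ≠ 0 := fun h => h0 (h ▸ (mem_filter.1 hi).1)
  have hpos (k : ℕ) : 0 ≤ (∏ i ∈ s with q ∣ i, cycleSeries i r).coeff k :=
    coeff_prod_nonneg (fun i _ => coeff_cycleSeries_nonneg i r) k
  have hzero {k : ℕ} (hk : ¬ q ∣ k) : (∏ i ∈ s with q ∣ i, cycleSeries i r).coeff k = 0 :=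
    coeff_prod_eq_zero_of_not_dvd (fun i hi k hk => coeff_cycleSeries_of_not_dvd fun h =>
      hk (((mem_filter.1 hi).2.mul_right r).trans h)) hk
  have hterm (a : ℕ) (ha : a < N) :
      0 ≤ (∏ i ∈ s with q ∣ i, cycleSeries i r).coeff a * D a := by
    by_cases hqa : q ∣ a
    · exact mul_nonneg (hpos a) (le_trans (by positivity) (hD a ha hqa))
    · rw [hzero hqa, zero_mul]
  have h := coeff_X_mul_derivative_prod_le (s := s.filter (q ∣ ·))
    (E := fun i => cycleSeries i r)
    (G := fun i => C ((i : ℚ) / (i ^ r * (r - 1).factorial)) * X ^ (i * r))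
    (fun i _ => coeff_cycleSeries_nonneg i r)
    (fun i hi => coeff_X_mul_derivative_cycleSeries_le (hs0 hi) (by omega)) N
  rw [coeff_X_mul_derivative, mul_sum, map_sum] at h
  have hN' : (0 : ℚ) < N := by exact_mod_cast hN
  refine le_of_mul_le_mul_left (h.trans ?_) hN'
  have hterm_le : ∀ i ∈ s.filter (q ∣ ·),
      ((∏ i ∈ s with q ∣ i, cycleSeries i r) *
        (C ((i : ℚ) / (i ^ r * (r - 1).factorial)) * X ^ (i * r))).coeff N ≤
      if i * r ≤ N then
        N * ((∏ i ∈ s with q ∣ i, cycleSeries i r).coeff (N - i * r) * D (N - i * r)) else 0 := by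
    intro i hi
    rw [mul_left_comm, coeff_C_mul, coeff_mul_X_pow']
    split_ifs with hir
    · have h1 := div_pow_mul_factorial_le hq (mem_filter.1 hi).2 (hs0 hi) hr hir
      have hir0 : 0 < i * r := Nat.mul_pos (Nat.pos_of_ne_zero (hs0 hi)) (by omega)
      have h2 := hD (N - i * r) (by omega)
        ((Nat.dvd_sub_iff_right hir hqN).2 ((mem_filter.1 hi).2.mul_right r))
      rw [Nat.sub_sub_self hir] at h2
      push_cast at h2
      rw [mul_left_comm (N : ℚ), mul_comm]
      exact mul_le_mul_of_nonneg_left (h1.trans (mul_le_mul_of_nonneg_left h2 hN'.le)) (hpos _)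
    · rw [mul_zero]
  refine (sum_le_sum hterm_le).trans ?_
  rw [← sum_filter, ← mul_sum]
  refine mul_le_mul_of_nonneg_left ?_ hN'.le
  set t := (s.filter (q ∣ ·)).filter (fun i => i * r ≤ N) with ht
  have hinj : Set.InjOn (fun i => N - i * r) t := by
    intro i hi j hj hij
    have h1 := (mem_filter.1 hi).2
    have h2 := (mem_filter.1 hj).2
    simp only at hij
    exact Nat.eq_of_mul_eq_mul_right (by omega : 0 < r) (by omega)
  rw [← sum_image (f := fun a => (∏ i ∈ s with q ∣ i, cycleSeries i r).coeff a * D a) hinj]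
  refine sum_le_sum_of_subset_of_nonneg (fun a ha => ?_)
    fun a ha _ => hterm a (mem_range.1 ha)
  obtain ⟨i, hi, rfl⟩ := mem_image.1 ha
  have : 0 < i * r := Nat.mul_pos (Nat.pos_of_ne_zero (hs0 (mem_filter.1 hi).1)) (by omega)
  exact mem_range.2 (by omega)

/-- for a prime power `r = q^l`, the probability `p_r(n)` that a
random permutation of `{1,…,n}` has an `r`-th root is nonincreasing in `n`. -/
theorem stmt19 (q l r : ℕ) (hq : Nat.Prime q) (hl : 1 ≤ l) (hr : r = q ^ l) :
    ∀ n : ℕ, 1 ≤ n →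
      (Nat.card {σ : Equiv.Perm (Fin n) // ∃ π, π ^ r = σ} : ℚ) / Nat.factorial n ≥
        (Nat.card {σ : Equiv.Perm (Fin (n + 1)) // ∃ π, π ^ r = σ} : ℚ) /
          Nat.factorial (n + 1) := by
  subst hr
  intro n _
  have hq2 := hq.two_le
  have hr2 : 2 ≤ q ^ l := hq2.trans (Nat.le_self_pow (by omega) q)
  obtain ⟨s, hs, h0, h⟩ := exists_finset_card_root_eq (l := l) hq (n + 1)
  rw [h n (by omega), h (n + 1) le_rfl, ← prod_filter_mul_prod_filter_not s (q ∣ ·),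
    prod_congr rfl fun i hi => by rw [if_pos (mem_filter.1 hi).2],
    prod_congr (s₁ := s.filter (¬ q ∣ ·)) rfl fun i hi => by rw [if_neg (mem_filter.1 hi).2]]
  have hstep := coeff_prod_cycleSeries_one_step hq2 hs h0
  have hle := coeff_prod_cycleSeries_le (N := n + 1) (s := s) hq2 hr2 n.succ_pos
  have hzero {k : ℕ} (hk : ¬ q ∣ k) : (∏ i ∈ s with q ∣ i, cycleSeries i (q ^ l)).coeff k = 0 :=
    coeff_prod_eq_zero_of_not_dvd (fun i hi k hk => coeff_cycleSeries_of_not_dvd fun h =>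
      hk (((mem_filter.1 hi).2.mul_right _).trans h)) hk
  have hone : (∏ i ∈ s with ¬ q ∣ i, cycleSeries i 1).coeff 0 = 1 := by
    rw [coeff_zero_eq_constantCoeff_apply, map_prod]
    refine prod_eq_one fun i _ => ?_
    rw [← coeff_zero_eq_constantCoeff_apply, cycleSeries, coeff_mk]
    simp
  have hlow := regular_lower_bound hq2
    (R := fun k => (∏ i ∈ s with ¬ q ∣ i, cycleSeries i 1).coeff k) hone hstep
  set H := ∏ i ∈ s with q ∣ i, cycleSeries i (q ^ l)
  set R := ∏ i ∈ s with ¬ q ∣ i, cycleSeries i 1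
  rw [ge_iff_le, coeff_mul, coeff_mul, Nat.sum_antidiagonal_eq_sum_range_succ_mk,
    Nat.sum_antidiagonal_eq_sum_range_succ_mk, sum_range_succ _ (n + 1), Nat.sub_self, hone,
    mul_one]
  by_cases hqn : q ∣ n + 1
  · have h1 := hle hqn h0 (D := fun a => R.coeff (n - a) - R.coeff (n + 1 - a)) fun a ha hqa => by
      have h2 : n + 1 - a = n - a + 1 := by omega
      rw [h2]
      have h3 := hlow (n - a) (by omega) (h2 ▸ Nat.dvd_sub hqn hqa)
      exact_mod_cast h3
    simp only [mul_sub, sum_sub_distrib] at h1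
    linarith
  · rw [hzero hqn, add_zero]
    refine sum_le_sum fun a ha => ?_
    rw [mem_range] at ha
    by_cases hqa : q ∣ a
    · rw [show n + 1 - a = n - a + 1 by omega, (hstep (n - a) (by omega)).1]
      rw [← Nat.sub_add_comm (by omega)]
      exact fun h => hqn ((Nat.dvd_sub_iff_left ha.le hqa).1 h)
    · rw [hzero hqa, zero_mul, zero_mul]
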